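/- Let m ≥ 2, n ≥ 2 and 1 ≤ p < n. In ℂ[x_1, ..., x_n], the ideal generated by the polynomials ∏_{i,j ∈ σ, i<j} (x_i^m − x_j^m), where σ ranges over all subsets of [n] of cardinality p+1, equals the intersection ⋂_λ ⟨x_i^m − x_j^m : i ≡_λ j⟩, where λ ranges over all partitions of [n] into exactly p blocks. -/

import Mathlib

open MvPolynomial

/-- The product of the differences `v i - v j` over all pairs `i < j` in `σ`. -/
def diffProd {A : Type*} [CommRing A] {n : ℕ} (v : Fin n → A) (σ : Finset (Fin n)) : A :=
  ∏ q ∈ Finset.univ.filter (fun q : Fin n × Fin n => q.1 < q.2 ∧ q.1 ∈ σ ∧ q.2 ∈ σ),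
    (v q.1 - v q.2)

theorem map_diffProd {A B F : Type*} [CommRing A] [CommRing B] [FunLike F A B] [RingHomClass F A B]
    (φ : F) {n : ℕ} (v : Fin n → A) (σ : Finset (Fin n)) :
    φ (diffProd v σ) = diffProd (fun i => φ (v i)) σ := by
  simp [diffProd, map_prod]

theorem diffProd_eq_prod_ite {A : Type*} [CommRing A] {n : ℕ} (v : Fin n → A)
    (σ : Finset (Fin n)) :
    diffProd v σ = ∏ i, ∏ j, if i < j ∧ i ∈ σ ∧ j ∈ σ then v i - v j else 1 := by
  rw [diffProd, Finset.prod_filter, Fintype.prod_prod_type]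

theorem diffProd_map_succ {A : Type*} [CommRing A] {n : ℕ} (v : Fin (n + 1) → A)
    (τ : Finset (Fin n)) :
    diffProd v (τ.map (Fin.succEmb n)) = diffProd (fun i => v i.succ) τ := by
  simp [diffProd_eq_prod_ite, Fin.prod_univ_succ]

theorem diffProd_insert_zero_map_succ {A : Type*} [CommRing A] {n : ℕ} (v : Fin (n + 1) → A)
    (τ : Finset (Fin n)) :
    diffProd v (insert 0 (τ.map (Fin.succEmb n))) =
      (∏ t ∈ τ, (v 0 - v t.succ)) * diffProd (fun i => v i.succ) τ := by
  simp [diffProd_eq_prod_ite, Fin.prod_univ_succ, Finset.prod_ite_mem, Fin.succ_ne_zero]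

theorem diffProd_dvd {A : Type*} [CommRing A] {n : ℕ} (v : Fin n → A) {σ : Finset (Fin n)}
    {i j : Fin n} (hi : i ∈ σ) (hj : j ∈ σ) (hij : i ≠ j) : v i - v j ∣ diffProd v σ := by
  rcases lt_or_gt_of_ne hij with h | h
  · exact Finset.dvd_prod_of_mem (fun q : Fin n × Fin n => v q.1 - v q.2) (a := (i, j))
      (by simp [*])
  · rw [← neg_sub, neg_dvd]
    exact Finset.dvd_prod_of_mem (fun q : Fin n × Fin n => v q.1 - v q.2) (a := (j, i))
      (by simp [*])

theorem diffProd_eq_zero_of_card_image_lt {A : Type*} [CommRing A] [DecidableEq A] {n : ℕ}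
    (v : Fin n → A) {σ : Finset (Fin n)} (h : (Finset.univ.image v).card < σ.card) :
    diffProd v σ = 0 := by
  obtain ⟨i, hi, j, hj, hij, hv⟩ := Finset.exists_ne_map_eq_of_card_lt_of_maps_to h
    (f := v) (fun i _ => by simp)
  simpa [hv] using diffProd_dvd v hi hj hij

section KleitmanLovasz

variable {K : Type*} [Field K]

/-- The ideal generated by the difference products of the variables over all `r`-subsets. -/
noncomputable def diffProdIdeal (K : Type*) [Field K] (n r : ℕ) : Ideal (MvPolynomial (Fin n) K) :=
  Ideal.span {f | ∃ σ : Finset (Fin n), σ.card = r ∧ f = diffProd X σ}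

theorem diffProd_mem_diffProdIdeal {n r : ℕ} {σ : Finset (Fin n)} (h : σ.card = r) :
    diffProd X σ ∈ diffProdIdeal K n r :=
  Ideal.subset_span ⟨σ, h, rfl⟩

/-- A polynomial vanishes on `p`-coloured points if it vanishes at every point
with at most `p` distinct coordinates. -/
def VanishesOnColored [DecidableEq K] {n : ℕ} (p : ℕ) (f : MvPolynomial (Fin n) K) : Prop :=
  ∀ x : Fin n → K, (Finset.univ.image x).card ≤ p → eval x f = 0

theorem vanishesOnColored_of_mem_diffProdIdeal [DecidableEq K] {n p : ℕ}
    {f : MvPolynomial (Fin n) K} (hf : f ∈ diffProdIdeal K n (p + 1)) :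
    VanishesOnColored p f := by
  intro x hx
  have : diffProdIdeal K n (p + 1) ≤ RingHom.ker (eval x) := by
    refine Ideal.span_le.2 ?_
    rintro _ ⟨σ, hσ, rfl⟩
    simp only [SetLike.mem_coe, RingHom.mem_ker, map_diffProd, eval_X]
    exact diffProd_eq_zero_of_card_image_lt x (by omega)
  exact this hf

theorem rename_succ_mem_diffProdIdeal {n r : ℕ} {g : MvPolynomial (Fin n) K}
    (hg : g ∈ diffProdIdeal K n r) : rename Fin.succ g ∈ diffProdIdeal K (n + 1) r := by
  have : diffProdIdeal K n r ≤ (diffProdIdeal K (n + 1) r).comap (rename Fin.succ) := by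
    refine Ideal.span_le.2 ?_
    rintro _ ⟨σ, hσ, rfl⟩
    simp only [SetLike.mem_coe, Ideal.mem_comap, map_diffProd, rename_X]
    rw [← diffProd_map_succ X]
    exact diffProd_mem_diffProdIdeal (by simpa)
  exact this hg

theorem finSuccEquiv_rename_succ {R : Type*} [CommRing R] {n : ℕ} (g : MvPolynomial (Fin n) R) :
    finSuccEquiv R n (rename Fin.succ g) = Polynomial.C g := by
  induction g using MvPolynomial.induction_on with
  | C a => rw [rename_C, finSuccEquiv_apply, eval₂Hom_C]; rfl
  | add g h ihg ihh => simp only [map_add, ihg, ihh]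
  | mul_X g i ih => rw [map_mul, map_mul, ih, rename_X, finSuccEquiv_X_succ, map_mul]

/-- Every element of the `r`-subset ideal in `n` variables is the top coefficient, in a new
variable, of an element of the `r + 1`-subset ideal. -/
theorem exists_mem_diffProdIdeal_coeff_eq {n r : ℕ} {h : MvPolynomial (Fin n) K}
    (hh : h ∈ diffProdIdeal K n r) :
    ∃ g ∈ diffProdIdeal K (n + 1) (r + 1),
      (finSuccEquiv K n g).natDegree ≤ r ∧ (finSuccEquiv K n g).coeff r = h := by
  induction hh using Submodule.span_induction with
  | mem f hf =>
    obtain ⟨τ, hτ, rfl⟩ := hf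
    refine ⟨_, diffProd_mem_diffProdIdeal (σ := insert 0 (τ.map (Fin.succEmb n))) ?_, ?_⟩
    · rw [Finset.card_insert_of_notMem (by simp [Fin.succ_ne_zero]), Finset.card_map, hτ]
    · rw [map_diffProd, diffProd_insert_zero_map_succ]
      simp only [finSuccEquiv_X_zero, finSuccEquiv_X_succ]
      have hdeg : (∏ t ∈ τ, (Polynomial.X - Polynomial.C (X t : MvPolynomial (Fin n) K))).natDegree
          = r := by rw [Polynomial.natDegree_finsetProd_X_sub_C_eq_card, hτ]
      have hmon := Polynomial.monic_prod_X_sub_C (fun t => (X t : MvPolynomial (Fin n) K)) τ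
      rw [← map_diffProd Polynomial.C]
      refine ⟨(Polynomial.natDegree_mul_C_le _ _).trans hdeg.le, ?_⟩
      rw [Polynomial.coeff_mul_C, ← hdeg, hmon.coeff_natDegree, one_mul]
  | zero => exact ⟨0, zero_mem _, by simp⟩
  | add a b _ _ iha ihb =>
    obtain ⟨g, hg, hd, hc⟩ := iha
    obtain ⟨g', hg', hd', hc'⟩ := ihb
    refine ⟨g + g', add_mem hg hg', ?_, by simp [hc, hc']⟩
    rw [map_add]
    exact Polynomial.natDegree_add_le_of_degree_le hd hd'
  | smul c a _ iha =>
    obtain ⟨g, hg, hd, hc⟩ := iha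
    refine ⟨rename Fin.succ c * g, Ideal.mul_mem_left _ _ hg, ?_, ?_⟩
    · rw [map_mul, finSuccEquiv_rename_succ]
      exact (Polynomial.natDegree_C_mul_le _ _).trans hd
    · rw [map_mul, finSuccEquiv_rename_succ, Polynomial.coeff_C_mul, hc, smul_eq_mul]

theorem image_cons {α : Type*} [DecidableEq α] {n : ℕ} (t : α) (y : Fin n → α) :
    Finset.univ.image (Fin.cons t y : Fin (n + 1) → α) = insert t (Finset.univ.image y) := by
  ext a
  simp [Fin.exists_fin_succ, eq_comm]

theorem coeff_finSuccEquiv_vanishesOnColored [Infinite K] [DecidableEq K] {n p : ℕ}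
    {f : MvPolynomial (Fin (n + 1)) K} (hf : VanishesOnColored (p + 1) f) (a : ℕ) :
    VanishesOnColored p ((finSuccEquiv K n f).coeff a) := by
  intro y hy
  have : Polynomial.map (eval y) (finSuccEquiv K n f) = 0 := by
    refine Polynomial.funext fun t => ?_
    rw [← eval_eq_eval_mv_eval', Polynomial.eval_zero]
    apply hf
    rw [image_cons]
    exact (Finset.card_insert_le _ _).trans (by omega)
  simpa using congrArg (fun P => Polynomial.coeff P a) this

/-- Small degree in the first variable leaves no room for a colour: all coefficients vanish. -/
theorem coeff_finSuccEquiv_vanishesOnColored_of_natDegree_lt [Infinite K] [DecidableEq K]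
    {n p : ℕ} {f : MvPolynomial (Fin (n + 1)) K} (hf : VanishesOnColored (p + 1) f)
    (hd : (finSuccEquiv K n f).natDegree < p + 1) (a : ℕ) :
    VanishesOnColored (p + 1) ((finSuccEquiv K n f).coeff a) := by
  intro y hy
  rcases Nat.lt_or_ge p (Finset.univ.image y).card with hlt | hle
  · have : Polynomial.map (eval y) (finSuccEquiv K n f) = 0 := by
      refine Polynomial.eq_zero_of_natDegree_lt_card_of_eval_eq_zero' _ (Finset.univ.image y)
        (fun t ht => ?_) ?_
      · rw [← eval_eq_eval_mv_eval']
        apply hf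
        rwa [image_cons, Finset.insert_eq_of_mem ht]
      · exact Polynomial.natDegree_map_le.trans_lt (hd.trans_le hlt)
    simpa using congrArg (fun P => Polynomial.coeff P a) this
  · exact coeff_finSuccEquiv_vanishesOnColored hf a y hle

theorem mem_diffProdIdeal_of_coeff_mem {n r : ℕ} {f : MvPolynomial (Fin (n + 1)) K}
    (hf : ∀ a, (finSuccEquiv K n f).coeff a ∈ diffProdIdeal K n r) :
    f ∈ diffProdIdeal K (n + 1) r := by
  have : f = ∑ a ∈ Finset.range ((finSuccEquiv K n f).natDegree + 1),
      rename Fin.succ ((finSuccEquiv K n f).coeff a) * X 0 ^ a := by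
    apply (finSuccEquiv K n).injective
    simp only [map_sum, map_mul, map_pow, finSuccEquiv_rename_succ, finSuccEquiv_X_zero]
    exact Polynomial.as_sum_range_C_mul_X_pow _
  rw [this]
  exact sum_mem fun a _ => Ideal.mul_mem_right _ _ (rename_succ_mem_diffProdIdeal (hf a))

/-- The Kleitman–Lovász theorem: a polynomial vanishing at all points with at most `p` distinct
coordinates lies in the ideal generated by the difference products over `p + 1`-subsets. -/
theorem mem_diffProdIdeal_of_vanishesOnColored [Infinite K] [DecidableEq K] {n p : ℕ}
    {f : MvPolynomial (Fin n) K} (hf : VanishesOnColored p f) :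
    f ∈ diffProdIdeal K n (p + 1) := by
  induction n generalizing p with
  | zero =>
    have h0 : f = 0 := by
      rw [eq_C_of_isEmpty f]
      have := hf isEmptyElim (by simp)
      rw [eq_C_of_isEmpty f, eval_C] at this
      rw [this, C_0]
    rw [h0]
    exact zero_mem _
  | succ n ih =>
    rcases p with _ | p
    · have h1 : (1 : MvPolynomial (Fin (n + 1)) K) ∈ diffProdIdeal K (n + 1) 1 := by
        have h0 : diffProd X ({0} : Finset (Fin (n + 1))) =
            (1 : MvPolynomial (Fin (n + 1)) K) := by
          refine Finset.prod_eq_one fun q hq => ?_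
          simp only [Finset.mem_filter, Finset.mem_singleton] at hq
          exact absurd hq.2.1 (by simp [hq.2.2])
        rw [← h0]
        exact diffProd_mem_diffProdIdeal rfl
      rw [(Ideal.eq_top_iff_one _).2 h1]
      trivial
    · induction hd : (finSuccEquiv K n f).natDegree using Nat.strong_induction_on
        generalizing f with
      | _ d ihd =>
      rcases Nat.lt_or_ge d (p + 1) with hlt | hge
      · exact mem_diffProdIdeal_of_coeff_mem fun a =>
          ih (coeff_finSuccEquiv_vanishesOnColored_of_natDegree_lt hf (hd ▸ hlt) a)
      · obtain ⟨g, hg, hgd, hgc⟩ := exists_mem_diffProdIdeal_coeff_eq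
          (ih (coeff_finSuccEquiv_vanishesOnColored hf d))
        have hg' : X 0 ^ (d - (p + 1)) * g ∈ diffProdIdeal K (n + 1) (p + 1 + 1) :=
          Ideal.mul_mem_left _ _ hg
        rw [← sub_add_cancel f (X 0 ^ (d - (p + 1)) * g)]
        refine add_mem (ihd _ ?_ (fun x hx => ?_) rfl) hg'
        · have hle : (finSuccEquiv K n (f - X 0 ^ (d - (p + 1)) * g)).natDegree ≤ d := by
            rw [map_sub, map_mul, map_pow, finSuccEquiv_X_zero]
            refine (Polynomial.natDegree_sub_le _ _).trans (max_le hd.le ?_)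
            refine Polynomial.natDegree_mul_le.trans ?_
            rw [Polynomial.natDegree_X_pow]
            omega
          have hc : (finSuccEquiv K n (f - X 0 ^ (d - (p + 1)) * g)).coeff d = 0 := by
            rw [map_sub, map_mul, map_pow, finSuccEquiv_X_zero, Polynomial.coeff_sub,
              Polynomial.coeff_X_pow_mul', if_pos (by omega),
              Nat.sub_sub_self hge, hgc, sub_self]
          refine lt_of_le_of_ne hle fun h => ?_
          have h0 := Polynomial.leadingCoeff_eq_zero.1 ((congrArg (Polynomial.coeff _) h).trans hc)
          rw [h0, Polynomial.natDegree_zero] at h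
          omega
        · rw [map_sub, hf x hx, vanishesOnColored_of_mem_diffProdIdeal hg' x hx, sub_zero]

end KleitmanLovasz

section ResiduePart

variable {R ι : Type*} [CommRing R]

open Classical in
/-- The component of a polynomial supported on exponents congruent to `a` modulo `m`, with
`m`-th powers of variables replaced by variables. -/
noncomputable def residuePart (R : Type*) [CommRing R] {ι : Type*} (m : ℕ) (a : ι → ℕ) :
    MvPolynomial ι R →ₗ[R] MvPolynomial ι R :=
  (basisMonomials ι R).constr R fun e =>
    if ∀ i, e i % m = a i then monomial (e.mapRange (· / m) (Nat.zero_div m)) 1 else 0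

open Classical in
theorem residuePart_monomial_one (m : ℕ) (a : ι → ℕ) (e : ι →₀ ℕ) :
    residuePart R m a (monomial e 1) =
      if ∀ i, e i % m = a i then monomial (e.mapRange (· / m) (Nat.zero_div m)) 1 else 0 := by
  have := (basisMonomials ι R).constr_basis R (fun e : ι →₀ ℕ =>
    if ∀ i, e i % m = a i then (monomial (e.mapRange (· / m) (Nat.zero_div m)) 1 :
      MvPolynomial ι R) else 0) e
  rwa [coe_basisMonomials] at this

theorem residuePart_X_pow_mul {m : ℕ} (hm : 0 < m) (a : ι → ℕ) (i : ι) (f : MvPolynomial ι R) :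
    residuePart R m a (X i ^ m * f) = X i * residuePart R m a f := by
  classical
  have : residuePart R m a ∘ₗ LinearMap.mulLeft R (X i ^ m) =
      LinearMap.mulLeft R (X i) ∘ₗ residuePart R m a := by
    refine (basisMonomials ι R).ext fun e => ?_
    have hmod : ∀ k, (Finsupp.single i m + e) k % m = e k % m := fun k => by
      by_cases h : i = k <;> simp [h]
    have hdiv : (Finsupp.single i m + e).mapRange (· / m) (Nat.zero_div m) =
        Finsupp.single i 1 + e.mapRange (· / m) (Nat.zero_div m) := by
      ext k
      by_cases h : i = k <;> simp [h, Nat.add_div_left _ hm, add_comm]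
    simp only [coe_basisMonomials, LinearMap.comp_apply, LinearMap.mulLeft_apply]
    rw [X_pow_eq_monomial, monomial_mul, one_mul, residuePart_monomial_one,
      residuePart_monomial_one, hdiv]
    simp only [hmod]
    split_ifs
    · rw [X, monomial_mul, one_mul]
    · rw [mul_zero]
  exact DFunLike.congr_fun this f

theorem eq_sum_monomial_mul_expand_residuePart [Fintype ι] [DecidableEq ι] {m : ℕ} (hm : 0 < m)
    (f : MvPolynomial ι R) :
    f = ∑ a : ι → Fin m, monomial (Finsupp.equivFunOnFinite.symm fun i => (a i : ℕ)) 1 *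
      expand m (residuePart R m (fun i => (a i : ℕ)) f) := by
  classical
  have : LinearMap.id = ∑ a : ι → Fin m, LinearMap.mulLeft R
        (monomial (Finsupp.equivFunOnFinite.symm fun i => (a i : ℕ)) 1) ∘ₗ
      (expand m : MvPolynomial ι R →ₐ[R] _).toLinearMap ∘ₗ
        residuePart R m (fun i => (a i : ℕ)) := by
    refine (basisMonomials ι R).ext fun e => ?_
    simp only [coe_basisMonomials, LinearMap.sum_apply, LinearMap.comp_apply, LinearMap.id_apply,
      LinearMap.mulLeft_apply, AlgHom.toLinearMap_apply, residuePart_monomial_one]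
    rw [Finset.sum_eq_single (fun i => ⟨e i % m, Nat.mod_lt _ hm⟩)]
    · rw [if_pos fun _ => rfl, expand_monomial, monomial_mul, one_mul]
      refine congrArg (fun d => monomial d (1 : R)) (Finsupp.ext fun k => ?_)
      simp [Nat.mod_add_div]
    · intro a _ ha
      rw [if_neg, map_zero, mul_zero]
      exact fun h => ha (funext fun i => Fin.ext (h i).symm)
    · simp
  simpa using DFunLike.congr_fun this f

theorem eval_residuePart_eq_zero {m : ℕ} (hm : 0 < m) (a : ι → ℕ) {r : ι → ι → Prop} {x : ι → R}
    (hx : ∀ i j, r i j → x i = x j) {f : MvPolynomial ι R}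
    (hf : f ∈ Ideal.span {g : MvPolynomial ι R | ∃ i j, r i j ∧ g = X i ^ m - X j ^ m}) :
    eval x (residuePart R m a f) = 0 := by
  suffices ∀ c, eval x (residuePart R m a (c * f)) = 0 by simpa using this 1
  induction hf using Submodule.span_induction with
  | mem g hg =>
    obtain ⟨i, j, hij, rfl⟩ := hg
    intro c
    rw [mul_comm, sub_mul, map_sub, residuePart_X_pow_mul hm, residuePart_X_pow_mul hm]
    simp [hx i j hij]
  | zero => simp
  | add g h _ _ ihg ihh => intro c; rw [mul_add, map_add, map_add, ihg, ihh, add_zero]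
  | smul b g _ ih => intro c; rw [smul_eq_mul, ← mul_assoc]; exact ih _

theorem mem_span_diffProd_X_pow {K : Type*} [Field K] [Infinite K] [DecidableEq K]
    {n m p : ℕ} (hm : 0 < m) {f : MvPolynomial (Fin n) K}
    (hf : ∀ a, VanishesOnColored p (residuePart K m a f)) :
    f ∈ Ideal.span {g : MvPolynomial (Fin n) K |
      ∃ σ : Finset (Fin n), σ.card = p + 1 ∧ g = diffProd (fun i => X i ^ m) σ} := by
  rw [eq_sum_monomial_mul_expand_residuePart hm f]
  refine sum_mem fun a _ => Ideal.mul_mem_left _ _ ?_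
  have : diffProdIdeal K n (p + 1) ≤ (Ideal.span {g : MvPolynomial (Fin n) K |
      ∃ σ : Finset (Fin n), σ.card = p + 1 ∧ g = diffProd (fun i => X i ^ m) σ}).comap
        (expand m) := by
    refine Ideal.span_le.2 ?_
    rintro _ ⟨σ, hσ, rfl⟩
    simp only [SetLike.mem_coe, Ideal.mem_comap, map_diffProd, expand_X]
    exact Ideal.subset_span ⟨σ, hσ, rfl⟩
  exact this (mem_diffProdIdeal_of_vanishesOnColored (hf _))

end ResiduePart

/-- A function with at most `p` values is constant on the parts of some partition into exactly
`p` parts. -/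
theorem exists_finpartition_card_eq_const {ι α : Type*} [Fintype ι] [DecidableEq ι]
    [DecidableEq α] (x : ι → α) {p : ℕ} (hx : (Finset.univ.image x).card ≤ p)
    (hp : p ≤ Fintype.card ι) :
    ∃ P : Finpartition (Finset.univ : Finset ι), P.parts.card = p ∧
      ∀ b ∈ P.parts, ∀ i ∈ b, ∀ j ∈ b, x i = x j := by
  let rep : ι → ι := fun i => Set.rangeSplitting x (Set.rangeFactorization x i)
  have hrep : ∀ i, x (rep i) = x i := fun i => Set.apply_rangeSplitting x _
  have hrep_eq : ∀ i j, x i = x j → rep i = rep j := fun i j h =>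
    congrArg (Set.rangeSplitting x) (Subtype.ext h)
  have hcard : (Finset.univ.image rep).card ≤ p := by
    refine (Finset.card_le_card_of_injOn x (fun i _ => by simp) ?_).trans hx
    intro a ha b hb hab
    simp only [Finset.coe_image, Finset.coe_univ, Set.image_univ, Set.mem_range] at ha hb
    obtain ⟨i, rfl⟩ := ha
    obtain ⟨j, rfl⟩ := hb
    exact hrep_eq _ _ (by rwa [hrep, hrep] at hab)
  obtain ⟨S, hS, -, rfl⟩ := Finset.exists_subsuperset_card_eq (Finset.subset_univ _) hcard hp
  let c : ι → ι := fun i => if i ∈ S then i else rep i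
  have hcS : ∀ i, c i ∈ S := fun i => by
    by_cases h : i ∈ S
    · simp [c, h]
    · simpa [c, h] using hS (Finset.mem_image_of_mem rep (Finset.mem_univ i))
  have hc : ∀ i ∈ S, c i = i := fun i hi => if_pos hi
  have hxc : ∀ i, x (c i) = x i := fun i => by
    by_cases h : i ∈ S <;> simp [c, h, hrep]
  let fiber : ι → Finset ι := fun s => Finset.univ.filter fun i => c i = s
  refine ⟨Finpartition.ofExistsUnique (S.image fiber) (fun _ _ => Finset.subset_univ _)
    (fun i _ => ⟨fiber (c i), ⟨Finset.mem_image_of_mem _ (hcS i), by simp [fiber]⟩, ?_⟩) ?_,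
    ?_, ?_⟩
  · rintro b ⟨hb, hib⟩
    obtain ⟨s, -, rfl⟩ := Finset.mem_image.1 hb
    rw [(Finset.mem_filter.1 hib).2]
  · intro h
    obtain ⟨s, hs, he⟩ := Finset.mem_image.1 h
    have : s ∈ fiber s := by simp [fiber, hc s hs]
    simp [he] at this
  · refine Finset.card_image_of_injOn fun s hs t _ hst => ?_
    have : s ∈ fiber t := by
      rw [← show fiber s = fiber t from hst]
      simp [fiber, hc s hs]
    rw [← hc s hs, (Finset.mem_filter.1 this).2]
  · intro b hb i hi j hj
    obtain ⟨s, -, rfl⟩ := Finset.mem_image.1 hb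
    rw [← hxc i, ← hxc j, (Finset.mem_filter.1 hi).2, (Finset.mem_filter.1 hj).2]

/-- In `ℂ[x_1,…,x_n]`, the ideal generated by the products
`∏_{i,j ∈ σ, i<j} (x_i^m - x_j^m)`, `σ` running over subsets of `{1,…,n}` of
cardinality `p+1`, equals the intersection `⋂_λ ⟨x_i^m - x_j^m : i ≡_λ j⟩`, where `λ`
runs over the partitions of `{1,…,n}` into exactly `p` blocks. -/
theorem kleitmanLovasz_monomial_ideal_eq_inf (m n p : ℕ) (hm : 2 ≤ m) (hn : 2 ≤ n)
    (hp : 1 ≤ p) (hpn : p < n) :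
    Ideal.span {f : MvPolynomial (Fin n) ℂ |
        ∃ σ : Finset (Fin n), σ.card = p + 1 ∧
          f = ∏ q ∈ Finset.univ.filter
              (fun q : Fin n × Fin n => q.1 < q.2 ∧ q.1 ∈ σ ∧ q.2 ∈ σ),
            (X q.1 ^ m - X q.2 ^ m)} =
      ⨅ P : {P : Finpartition (Finset.univ : Finset (Fin n)) // P.parts.card = p},
        Ideal.span {f : MvPolynomial (Fin n) ℂ |
          ∃ i j : Fin n, (∃ b ∈ P.1.parts, i ∈ b ∧ j ∈ b) ∧ f = X i ^ m - X j ^ m} := by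
  classical
  apply le_antisymm
  · refine le_iInf fun ⟨P, hP⟩ => Ideal.span_le.2 ?_
    rintro _ ⟨σ, hσ, rfl⟩
    obtain ⟨i, hi, j, hj, hij, hpart⟩ := Finset.exists_ne_map_eq_of_card_lt_of_maps_to
      (s := σ) (t := P.parts) (by omega) (f := P.part) (fun i _ => by simp)
    refine Ideal.mem_of_dvd _ (diffProd_dvd (fun i => (X i : MvPolynomial (Fin n) ℂ) ^ m) hi hj hij)
      (Ideal.subset_span ⟨i, j, ⟨P.part i, by simp, by simp, ?_⟩, rfl⟩)
    rw [hpart]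
    simp
  · intro f hf
    refine mem_span_diffProd_X_pow (by omega) fun a x hx => ?_
    obtain ⟨P, hP, hconst⟩ := exists_finpartition_card_eq_const x hx (by simpa using hpn.le)
    refine eval_residuePart_eq_zero (r := fun i j => ∃ b ∈ P.parts, i ∈ b ∧ j ∈ b) (by omega) a ?_
      ((Submodule.mem_iInf _).1 hf ⟨P, hP⟩)
    rintro i j ⟨b, hb, hi, hj⟩
    exact hconst b hb i hi j hj
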